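/- Let K be a field of characteristic 0. Then every finite subgroup of PGL₂(K) is isomorphic to one of the following groups: a cyclic group ℤ/nℤ (n ≥ 1), a dihedral group D_n of order 2n (n ≥ 2), the alternating group A₄, the symmetric group S₄, or the alternating group A₅. -/

import Mathlib

/-- `PGL₂(k)`: the quotient of `GL₂(k)` by its center (the nonzero scalar matrices). -/
abbrev PGL2 (k : Type) [Field k] : Type :=
  GL (Fin 2) k ⧸ Subgroup.center (GL (Fin 2) k)

open Matrix OnePoint in
lemma ncard_fixed {L : Type} [Field L] [DecidableEq L] [IsAlgClosed L] [CharZero L]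
    (g : GL (Fin 2) L)
    (hs : g.val ∉ Set.range (Matrix.scalar (Fin 2))) (hp : ¬ g.IsParabolic) :
    (MulAction.fixedBy (OnePoint L) g).ncard = 2 := by
  have hd : g.val.discr ≠ 0 := fun h => hp ⟨hs, h⟩
  rw [discr_fin_two, trace_fin_two, det_fin_two] at hd
  have key : ∀ x : L, g • (x : OnePoint L) = x ↔
      g 1 0 * x ^ 2 + (g 1 1 - g 0 0) * x - g 0 1 = 0 := by
    intro x
    rw [← GeneralLinearGroup.fixpointPolynomial_aeval_eq_zero_iff]
    simp [GeneralLinearGroup.fixpointPolynomial]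
  by_cases hc : g 1 0 = 0
  · have hne : g 1 1 - g 0 0 ≠ 0 := by
      intro h
      apply hd
      change g 1 0 = 0 at hc
      have : g 1 1 = g 0 0 := by linear_combination h
      simp [hc, this]; ring
    have : MulAction.fixedBy (OnePoint L) g =
        {∞, ((g 0 1 / (g 1 1 - g 0 0) : L) : OnePoint L)} := by
      ext x
      rw [MulAction.mem_fixedBy]
      cases x with
      | infty => simp [smul_infty_eq_self_iff, hc]
      | coe x =>
        rw [key, hc]
        simp only [Set.mem_insert_iff, Set.mem_singleton_iff, OnePoint.coe_ne_infty, false_or,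
          OnePoint.coe_eq_coe]
        rw [eq_div_iff hne]
        constructor <;> intro h <;> linear_combination h
    rw [this, Set.ncard_pair (by simp)]
  · obtain ⟨s, hsq⟩ := IsAlgClosed.exists_pow_nat_eq ((g 0 0 - g 1 1)^2 + 4 * g 0 1 * g 1 0)
      (n := 2) (by norm_num)
    have hs0 : s ≠ 0 := by
      rintro rfl
      apply hd
      linear_combination -hsq
    have : MulAction.fixedBy (OnePoint L) g =
        {(((g 0 0 - g 1 1 + s) / (2 * g 1 0) : L) : OnePoint L),
         (((g 0 0 - g 1 1 - s) / (2 * g 1 0) : L) : OnePoint L)} := by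
      ext x
      rw [MulAction.mem_fixedBy]
      cases x with
      | infty => simp [smul_infty_eq_self_iff, hc]
      | coe x =>
        rw [key]
        simp only [Set.mem_insert_iff, Set.mem_singleton_iff, OnePoint.coe_eq_coe]
        have h2c : 2 * g 1 0 ≠ 0 := mul_ne_zero two_ne_zero hc
        rw [eq_div_iff h2c, eq_div_iff h2c, ← sub_eq_zero (b := g 0 0 - g 1 1 + s), ← sub_eq_zero (b := g 0 0 - g 1 1 - s),
          ← mul_eq_zero]
        constructor
        · intro h; linear_combination 4 * g 1 0 * h - hsq
        · intro h
          have : 4 * g 1 0 * (g 1 0 * x ^ 2 + (g 1 1 - g 0 0) * x - g 0 1) = 0 := by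
            linear_combination h + hsq
          exact (mul_eq_zero.1 this).resolve_left (mul_ne_zero (by norm_num) hc)
    rw [this, Set.ncard_pair]
    rw [Ne, OnePoint.coe_eq_coe, div_left_inj' (mul_ne_zero two_ne_zero hc)]
    intro h
    apply hs0
    have : 2 * s = 0 := by linear_combination h
    simpa using this

open Matrix in
lemma mem_center_iff_range {L : Type} [Field L] (g : GL (Fin 2) L) :
    g ∈ Subgroup.center (GL (Fin 2) L) ↔ g.val ∈ Set.range (Matrix.scalar (Fin 2)) := by
  rw [GeneralLinearGroup.center_eq_range_scalar]
  constructor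
  · rintro ⟨u, rfl⟩; exact ⟨u, rfl⟩
  · rintro ⟨u, hu⟩
    have : u ≠ 0 := by
      rintro rfl
      have := g.det_ne_zero
      rw [← hu] at this
      simp at this
    exact ⟨Units.mk0 u this, Units.ext hu⟩

open Matrix in
lemma map_range_iff {K L : Type} [Field K] [Field L] [Algebra K L] (g : GL (Fin 2) K) :
    (GeneralLinearGroup.map (algebraMap K L) g).val ∈ Set.range (Matrix.scalar (Fin 2)) ↔
     g.val ∈ Set.range (Matrix.scalar (Fin 2)) := by
  constructor
  · rintro ⟨u, hu⟩
    have h : ∀ i j, algebraMap K L (g i j) = Matrix.scalar (Fin 2) u i j := by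
      intro i j; rw [hu]; rfl
    refine ⟨g 0 0, ?_⟩
    have h00 := h 0 0
    have h01 := h 0 1
    have h10 := h 1 0
    have h11 := h 1 1
    simp at h00 h01 h10 h11
    rw [← h00] at h11
    have := (algebraMap K L).injective h11
    ext i j
    fin_cases i <;> fin_cases j <;> simp [h01, h10, this]
  · rintro ⟨u, hu⟩
    refine ⟨algebraMap K L u, ?_⟩
    ext i j
    change _ = algebraMap K L (g.val i j)
    rw [← hu]
    fin_cases i <;> fin_cases j <;> simp

open Matrix OnePoint in
lemma center_smul {L : Type} [Field L] [DecidableEq L] (g : GL (Fin 2) L)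
    (hg : g.val ∈ Set.range (Matrix.scalar (Fin 2))) (x : OnePoint L) : g • x = x := by
  have h0 := GeneralLinearGroup.fixpointPolynomial_eq_zero_iff.2 hg
  cases x with
  | infty =>
    rw [smul_infty_eq_self_iff]
    obtain ⟨u, hu⟩ := hg
    rw [← hu]; simp
  | coe x =>
    rw [← GeneralLinearGroup.fixpointPolynomial_aeval_eq_zero_iff, h0]; simp

open Matrix in
noncomputable def phi (K L : Type) [Field K] [Field L] [DecidableEq L] [Algebra K L] :
    PGL2 K →* Equiv.Perm (OnePoint L) :=
  QuotientGroup.lift _ ((MulAction.toPermHom (GL (Fin 2) L) (OnePoint L)).comp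
    (GeneralLinearGroup.map (algebraMap K L))) (by
      intro g hg
      ext x
      simp only [MonoidHom.comp_apply, MulAction.toPermHom_apply, MulAction.toPerm_apply]
      rw [center_smul _ ((map_range_iff g).2 ((mem_center_iff_range g).1 hg))]
      rfl)

open Matrix in
lemma phi_mk (K L : Type) [Field K] [Field L] [DecidableEq L] [Algebra K L] (g : GL (Fin 2) K)
    (x : OnePoint L) :
    phi K L (QuotientGroup.mk g) x = GeneralLinearGroup.map (algebraMap K L) g • x := rfl

open Matrix in
lemma not_parabolic {K L : Type} [Field K] [Field L] [CharZero L] [Algebra K L] (g : GL (Fin 2) K)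
    (hf : IsOfFinOrder (QuotientGroup.mk g : PGL2 K)) :
    ¬ (GeneralLinearGroup.map (algebraMap K L) g).IsParabolic := by
  intro hp
  obtain ⟨n, hn, h1⟩ := isOfFinOrder_iff_pow_eq_one.1 hf
  rw [← QuotientGroup.mk_pow, QuotientGroup.eq_one_iff, mem_center_iff_range,
    ← map_range_iff (L := L), map_pow] at h1
  exact (hp.pow hn.ne').1 h1

lemma exists_smul_infty {L : Type} [Field L] [DecidableEq L] (x : OnePoint L) :
    ∃ A : GL (Fin 2) L, A • (OnePoint.infty : OnePoint L) = x := by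
  cases x with
  | infty => exact ⟨1, one_smul _ _⟩
  | coe k =>
    refine ⟨Matrix.GeneralLinearGroup.mkOfDetNeZero !![k, 1; 1, 0] (by simp), ?_⟩
    rw [OnePoint.smul_infty_eq_ite]
    simp [Matrix.GeneralLinearGroup.mkOfDetNeZero]

open Matrix in
lemma stab_cyclic {K L : Type} [Field K] [Field L] [DecidableEq L] [CharZero L] [Algebra K L]
    (S : Subgroup (PGL2 K)) [Finite S] (x : OnePoint L) (hS : ∀ h ∈ S, phi K L h x = x) :
    IsCyclic S := by
  obtain ⟨A, hA⟩ := exists_smul_infty x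
  let B : GL (Fin 2) K → GL (Fin 2) L :=
    fun g => A⁻¹ * GeneralLinearGroup.map (algebraMap K L) g * A
  have hB : ∀ g h, B (g * h) = B g * B h := by intro g h; simp [B, mul_assoc]
  have hB10 : ∀ g, (QuotientGroup.mk g : PGL2 K) ∈ S → B g 1 0 = 0 := by
    intro g hg
    rw [← OnePoint.smul_infty_eq_self_iff]
    have := hS _ hg
    rw [phi_mk, ← hA] at this
    simp only [B, mul_smul, this, inv_smul_smul]
  have hne : ∀ g, (QuotientGroup.mk g : PGL2 K) ∈ S → B g 0 0 ≠ 0 ∧ B g 1 1 ≠ 0 := by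
    intro g hg
    have := (B g).det_ne_zero
    rw [det_fin_two, hB10 g hg] at this
    simpa using this
  have hBs : ∀ g, g.val ∈ Set.range (Matrix.scalar (Fin 2)) ↔
      (B g).val ∈ Set.range (Matrix.scalar (Fin 2)) := by
    intro g
    rw [← map_range_iff (L := L), ← mem_center_iff_range, ← mem_center_iff_range]
    have := (Subgroup.center (GL (Fin 2) L)).normal_of_characteristic
    constructor
    · intro h
      simpa [B] using this.conj_mem _ h A⁻¹
    · intro h
      simpa [B, mul_assoc] using this.conj_mem _ h A
  let r : GL (Fin 2) K → L := fun g => B g 0 0 / B g 1 1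
  have hr : ∀ g h, (QuotientGroup.mk g : PGL2 K) ∈ S → (QuotientGroup.mk h : PGL2 K) ∈ S →
      r (g * h) = r g * r h := by
    intro g h hg hh
    have h1 := hB10 g hg
    have h2 := hB10 h hh
    simp only [r, hB]
    simp [Matrix.mul_apply, h1, h2, mul_div_mul_comm]
  have hrs : ∀ g, (QuotientGroup.mk g : PGL2 K) ∈ S → (r g = 1 ↔ (QuotientGroup.mk g : PGL2 K) = 1) := by
    intro g hg
    rw [QuotientGroup.eq_one_iff, mem_center_iff_range, hBs]
    simp only [r]
    rw [div_eq_one_iff_eq (hne g hg).2]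
    constructor
    · intro h
      have hfin : IsOfFinOrder (QuotientGroup.mk g : PGL2 K) := by
        have := isOfFinOrder_of_finite (⟨_, hg⟩ : S)
        exact (Submonoid.isOfFinOrder_coe (H := S.toSubmonoid)).2 this
      have hp := not_parabolic (L := L) g hfin
      have hp' : ¬ (B g).IsParabolic := by
        simpa [B] using hp
      rw [GeneralLinearGroup.isParabolic_iff_of_upperTriangular (hB10 g hg)] at hp'
      have h01 : B g 0 1 = 0 := by
        by_contra h'; exact hp' ⟨h, h'⟩
      refine ⟨B g 0 0, ?_⟩
      have := hB10 g hg
      ext i j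
      fin_cases i <;> fin_cases j <;> simp [h01, this, h]
    · rintro ⟨u, hu⟩
      rw [← hu]; simp
  have hout : ∀ h : PGL2 K, (QuotientGroup.mk (Quotient.out h) : PGL2 K) = h := fun h => Quotient.out_eq h
  have hrw : ∀ g h, (QuotientGroup.mk g : PGL2 K) ∈ S → (QuotientGroup.mk g : PGL2 K) = QuotientGroup.mk h → r g = r h := by
    intro g h hg e
    have hh : (QuotientGroup.mk h : PGL2 K) ∈ S := e ▸ hg
    have e2 : h = g * (g⁻¹ * h) := by group
    have hq : (QuotientGroup.mk (g⁻¹ * h) : PGL2 K) = 1 := by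
      rw [QuotientGroup.mk_mul, QuotientGroup.mk_inv, e, inv_mul_cancel]
    have hq' : (QuotientGroup.mk (g⁻¹ * h) : PGL2 K) ∈ S := hq ▸ S.one_mem
    rw [e2, hr _ _ hg hq', (hrs _ hq').2 hq, mul_one]
  let f : S →* L :=
    { toFun := fun h => r (Quotient.out h.1)
      map_one' := by
        rw [hrs _ (by rw [hout]; exact S.one_mem), hout]; rfl
      map_mul' := by
        intro a b
        rw [← hr _ _ (by rw [hout]; exact a.2) (by rw [hout]; exact b.2)]
        apply hrw
        · rw [hout]; exact (a * b).2
        · rw [QuotientGroup.mk_mul, hout, hout, hout]; rfl }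
  refine isCyclic_of_injective_ringHom f ?_
  have hinj : ∀ a, f a = 1 → a = 1 := by
    intro a ha
    have := (hrs _ (by rw [hout]; exact a.2)).1 ha
    rw [hout] at this
    exact Subtype.ext this
  intro a b hab
  rw [← mul_inv_eq_one]
  apply hinj
  rw [map_mul, hab, ← map_mul, mul_inv_cancel, map_one]


lemma dihedral_of {G : Type} [Group G] [Finite G] (C : Subgroup G) (hC : C.index = 2)
    (hcyc : IsCyclic C) (hinv : ∀ g, g ∉ C → g * g = 1) :
    Nonempty (G ≃* DihedralGroup (Nat.card C)) := by
  let e := zmodCyclicMulEquiv hcyc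
  let c : ZMod (Nat.card C) → G := fun i => (e (Multiplicative.ofAdd i) : G)
  have hcC : ∀ i, c i ∈ C := fun i => (e (Multiplicative.ofAdd i)).2
  have hadd : ∀ i j, c (i + j) = c i * c j := by
    intro i j; simp [c, ofAdd_add]
  have hc0 : c 0 = 1 := by simp [c]
  have hcinj : Function.Injective c := by
    intro i j h
    exact Multiplicative.ofAdd.injective (e.injective (Subtype.ext h))
  have hneg : ∀ i, c (-i) = (c i)⁻¹ := by
    intro i
    rw [eq_inv_iff_mul_eq_one, ← hadd, neg_add_cancel, hc0]
  obtain ⟨s, hs⟩ : ∃ s, s ∉ C := by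
    by_contra h
    push Not at h
    have : C = ⊤ := by ext x; simp [h x]
    rw [this] at hC
    simp at hC
  have hss : s * s = 1 := hinv s hs
  have hsc : ∀ i, s * c i ∉ C := by
    intro i h
    rw [Subgroup.mul_mem_iff_of_index_two hC] at h
    exact hs (h.2 (hcC i))
  have hcs : ∀ i, c i * s = s * c (-i) := by
    intro i
    have h1 := hinv _ (hsc i)
    rw [hneg, eq_mul_inv_iff_mul_eq]
    have hs' : s⁻¹ = s := inv_eq_of_mul_eq_one_right hss
    calc c i * s * c i = s⁻¹ * (s * c i * (s * c i)) := by group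
      _ = s := by rw [h1, mul_one, hs']
  let f : DihedralGroup (Nat.card C) →* G :=
    { toFun := fun x => match x with
        | .r i => c i
        | .sr i => s * c i
      map_one' := by rw [DihedralGroup.one_def]; exact hc0
      map_mul' := by
        rintro (i | i) (j | j)
        · simp only [DihedralGroup.r_mul_r, hadd]
        · simp only [DihedralGroup.r_mul_sr]
          rw [← mul_assoc, hcs, mul_assoc, ← hadd]; congr 2; ring
        · simp only [DihedralGroup.sr_mul_r, hadd, mul_assoc]
        · simp only [DihedralGroup.sr_mul_sr]
          rw [mul_assoc, ← mul_assoc (c i), hcs, mul_assoc, ← mul_assoc s, hss, one_mul, ← hadd]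
          congr 1; ring }
  have hf : Function.Injective f := by
    rintro (i | i) (j | j) h
    · have : c i = c j := h
      rw [hcinj this]
    · have : c i = s * c j := h
      exact absurd (this ▸ hcC i) (hsc j)
    · have : s * c i = c j := h
      exact absurd (this.symm ▸ hcC j) (hsc i)
    · have : s * c i = s * c j := h
      rw [hcinj (mul_left_cancel this)]
  have : Function.Bijective f := by
    have : Finite (DihedralGroup (Nat.card C)) := Finite.of_injective f hf
    refine (Nat.bijective_iff_injective_and_card f).2 ⟨hf, ?_⟩
    rw [DihedralGroup.nat_card, ← C.index_mul_card, hC]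
  exact ⟨(MulEquiv.ofBijective f this).symm⟩

lemma perm_of {G α : Type} [Group G] [Finite G] [Finite α] (n : ℕ) (hα : Nat.card α = n)
    (f : G →* Equiv.Perm α) (hf : f.ker = ⊥) (hG : Nat.card G = n.factorial) :
    Nonempty (G ≃* Equiv.Perm (Fin n)) := by
  subst hα
  have hb : Function.Bijective f := by
    refine (Nat.bijective_iff_injective_and_card f).2 ⟨(MonoidHom.ker_eq_bot_iff f).1 hf, ?_⟩
    rw [hG, Nat.card_perm]
  exact ⟨(MulEquiv.ofBijective f hb).trans (Finite.equivFin α).permCongrHom⟩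

lemma alt_of {G α : Type} [Group G] [Finite G] [Finite α] (n : ℕ) (hα : Nat.card α = n)
    (f : G →* Equiv.Perm α) (hf : f.ker = ⊥) (hG : 2 * Nat.card G = n.factorial) :
    Nonempty (G ≃* alternatingGroup (Fin n)) := by
  subst hα
  let f' : G →* Equiv.Perm (Fin (Nat.card α)) :=
    ((Finite.equivFin α).permCongrHom.toMonoidHom).comp f
  have hinj : Function.Injective f' :=
    (Finite.equivFin α).permCongrHom.injective.comp ((MonoidHom.ker_eq_bot_iff f).1 hf)
  have hcard : Nat.card f'.range = Nat.card G :=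
    Nat.card_congr (MonoidHom.ofInjective hinj).toEquiv.symm
  have hidx : f'.range.index = 2 := by
    have h1 := f'.range.index_mul_card
    rw [hcard, Nat.card_perm, Nat.card_fin, ← hG] at h1
    exact Nat.eq_of_mul_eq_mul_right Nat.card_pos h1
  have := Equiv.Perm.eq_alternatingGroup_of_index_eq_two hidx
  exact ⟨(MonoidHom.ofInjective hinj).trans (MulEquiv.subgroupCongr this)⟩

/-- counting elements of order `p` via Sylow subgroups -/
lemma card_order_eq {G : Type} [Group G] [Finite G] (p m : ℕ) [Fact p.Prime]
    (hcard : ∀ P : Sylow p G, Nat.card P = m)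
    (hord : ∀ P : Sylow p G, ∀ g ∈ P, g ≠ 1 → orderOf g = p)
    (hTI : ∀ P Q : Sylow p G, ∀ g ∈ P, g ∈ Q → g ≠ 1 → P = Q) :
    Nat.card {g : G // orderOf g = p} = Nat.card (Sylow p G) * (m - 1) := by
  have hp : p.Prime := Fact.out
  let F : (Σ P : Sylow p G, {g : P // g ≠ 1}) → {g : G // orderOf g = p} := fun a =>
    ⟨a.2.1.1, hord a.1 _ a.2.1.2 (fun h => a.2.2 (Subtype.ext h))⟩
  have hF : Function.Bijective F := by
    constructor
    · rintro ⟨P, ⟨g, hg⟩, hg1⟩ ⟨Q, ⟨h, hh⟩, hh1⟩ hab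
      have e : g = h := congrArg Subtype.val hab
      subst e
      have : P = Q := hTI P Q g hg hh (fun h => hg1 (Subtype.ext h))
      subst this
      rfl
    · rintro ⟨g, hg⟩
      have : IsPGroup p (Subgroup.zpowers g) := by
        apply IsPGroup.of_card (n := 1)
        rw [Nat.card_zpowers, hg, pow_one]
      obtain ⟨Q, hQ⟩ := this.exists_le_sylow
      refine ⟨⟨Q, ⟨g, hQ (Subgroup.mem_zpowers g)⟩, ?_⟩, rfl⟩
      intro h
      have : g = 1 := congrArg Subtype.val h
      rw [this, orderOf_one] at hg
      exact hp.one_lt.ne hg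
  classical
  have : Fintype (Sylow p G) := Fintype.ofFinite _
  rw [← Nat.card_congr (Equiv.ofBijective F hF), Nat.card_sigma]
  have : ∀ P : Sylow p G, Nat.card {g : P // g ≠ 1} = m - 1 := by
    intro P
    have : Fintype P := Fintype.ofFinite _
    rw [← hcard P, Nat.card_eq_fintype_card, Nat.card_eq_fintype_card,
      Fintype.card_subtype_compl, Fintype.card_subtype_eq]
    rfl
  simp [this]

lemma S4_of {G : Type} [Group G] [Finite G] (hG : Nat.card G = 24)
    (h6 : ∀ g : G, orderOf g ≠ 6) (h3 : Nat.card {g : G // orderOf g = 3} = 8) :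
    Nonempty (G ≃* Equiv.Perm (Fin 4)) := by
  have : Fact (Nat.Prime 3) := ⟨by norm_num⟩
  have hcard : ∀ P : Sylow 3 G, Nat.card P = 3 := by
    intro P
    rw [Sylow.card_eq_multiplicity, hG]
    have : (24 : ℕ).factorization 3 = 1 := by
      rw [Nat.factorization_def _ (by norm_num)]
      have : (24:ℕ) = 3 * 8 := rfl
      rw [this, padicValNat.mul (by norm_num) (by norm_num), padicValNat.self (by norm_num),
        padicValNat.eq_zero_of_not_dvd (by norm_num)]
    rw [this, pow_one]
  have hord : ∀ P : Sylow 3 G, ∀ g ∈ P, g ≠ 1 → orderOf g = 3 := by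
    intro P g hg hg1
    have h := Subgroup.orderOf_dvd_natCard (P : Subgroup G) hg
    have h' := hcard P
    change Nat.card (P : Subgroup G) = 3 at h'
    rw [h'] at h
    rcases (Nat.dvd_prime (by norm_num)).1 h with h | h
    · exact absurd (orderOf_eq_one_iff.1 h) hg1
    · exact h
  have heq : ∀ P : Sylow 3 G, ∀ g ∈ P, g ≠ 1 → Subgroup.zpowers g = P := by
    intro P g hg hg1
    apply Subgroup.eq_of_le_of_card_ge
    · exact Subgroup.zpowers_le.2 hg
    · rw [Nat.card_zpowers, hord P g hg hg1]; exact (hcard P).le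
  have hTI : ∀ P Q : Sylow 3 G, ∀ g ∈ P, g ∈ Q → g ≠ 1 → P = Q := by
    intro P Q g hP hQ hg1
    apply Sylow.ext
    rw [← heq P g hP hg1, heq Q g hQ hg1]
  have hn := card_order_eq 3 3 hcard hord hTI
  rw [h3] at hn
  have hn4 : Nat.card (Sylow 3 G) = 4 := by omega
  refine perm_of 4 hn4 (MulAction.toPermHom G (Sylow 3 G)) ?_ (by rw [hG]; rfl)
  set N := (MulAction.toPermHom G (Sylow 3 G)).ker with hN
  have hmem : ∀ g ∈ N, ∀ P : Sylow 3 G, g • P = P := by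
    intro g hg P
    rw [hN, MonoidHom.mem_ker] at hg
    exact congrArg (fun σ => σ P) hg
  obtain ⟨P⟩ : Nonempty (Sylow 3 G) := inferInstance
  have hNle : N ≤ Subgroup.normalizer (P : Set G) := by
    intro g hg
    exact Sylow.smul_eq_iff_mem_normalizer.1 (hmem g hg P)
  have hcN : Nat.card (Subgroup.normalizer (P : Set G)) = 6 := by
    have h1 := (Subgroup.normalizer (P : Set G)).index_mul_card
    have h2 := Sylow.card_eq_index_normalizer P
    rw [hn4] at h2
    rw [← h2, hG] at h1
    omega
  have hd6 : Nat.card N ∣ 6 := hcN ▸ Subgroup.card_dvd_of_le hNle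
  have hno3 : ¬ 3 ∣ Nat.card N := by
    intro h
    obtain ⟨u, hu⟩ := exists_prime_orderOf_dvd_card' (G := N) 3 h
    have hu' : orderOf (u : G) = 3 := by rw [Subgroup.orderOf_coe, hu]
    have hu1 : (u : G) ≠ 1 := by
      intro h; rw [h, orderOf_one] at hu'; norm_num at hu'
    have hpg : IsPGroup 3 (Subgroup.zpowers (u : G)) := by
      apply IsPGroup.of_card (n := 1)
      rw [Nat.card_zpowers, hu', pow_one]
    have hall : ∀ Q : Sylow 3 G, (u : G) ∈ Q := by
      intro Q
      have : Q ∈ MulAction.fixedPoints (Subgroup.zpowers (u : G)) (Sylow 3 G) := by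
        rintro ⟨g, hg⟩
        have : g ∈ N := (Subgroup.zpowers_le.2 u.2) hg
        exact hmem g this Q
      exact hpg.sylow_mem_fixedPoints_iff.1 this (Subgroup.mem_zpowers _)
    have : Subsingleton (Sylow 3 G) := ⟨fun Q R => hTI Q R u (hall Q) (hall R) hu1⟩
    have : Nat.card (Sylow 3 G) ≤ 1 := Finite.card_le_one_iff_subsingleton.2 this
    omega
  have hc2 : Nat.card N = 1 ∨ Nat.card N = 2 := by
    have := Nat.le_of_dvd (by norm_num) hd6
    interval_cases h : Nat.card N <;> simp_all
  rcases hc2 with h1 | h2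
  · exact Subgroup.card_eq_one.1 h1
  · exfalso
    obtain ⟨k, hk⟩ := exists_prime_orderOf_dvd_card' (G := N) 2 (by rw [h2])
    have hk' : orderOf (k : G) = 2 := by rw [Subgroup.orderOf_coe, hk]
    have hk1 : k ≠ 1 := by
      intro h; rw [h, orderOf_one] at hk; norm_num at hk
    obtain ⟨u, hu⟩ := exists_prime_orderOf_dvd_card' (G := G) 3 (by rw [hG]; norm_num)
    have hnorm : N.Normal := MonoidHom.normal_ker _
    let k' : N := ⟨u * k * u⁻¹, hnorm.conj_mem k k.2 u⟩
    have hk'1 : k' ≠ 1 := by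
      intro h
      have : u * (k : G) * u⁻¹ = 1 := congrArg Subtype.val h
      rw [conj_eq_one_iff] at this
      exact hk1 (Subtype.ext this)
    have hkk : k' = k := by
      obtain ⟨y, _, hy⟩ := (Nat.card_eq_two_iff' (1 : N)).1 h2
      rw [hy k' hk'1, hy k hk1]
    have hcomm : Commute u (k : G) := by
      have : u * (k : G) * u⁻¹ = k := congrArg Subtype.val hkk
      exact mul_inv_eq_iff_eq_mul.1 this
    apply h6 (u * k)
    rw [hcomm.orderOf_mul_eq_mul_orderOf_of_coprime (by rw [hu, hk']; norm_num), hu, hk']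

lemma A5_of {G : Type} [Group G] [Finite G] (hG : Nat.card G = 60)
    (hord : ∀ g : G, g ≠ 1 → orderOf g = 2 ∨ orderOf g = 3 ∨ orderOf g = 5)
    (h2 : Nat.card {g : G // orderOf g = 2} = 15)
    (h3 : Nat.card {g : G // orderOf g = 3} = 20)
    (h5 : Nat.card {g : G // orderOf g = 5} = 24)
    (hK : ∀ (N : Subgroup G), N.Normal → ∀ p, p = 2 ∨ p = 3 ∨ p = 5 → ∀ g ∈ N, orderOf g = p →
      ∀ h, orderOf h = p → h ∈ N) :
    Nonempty (G ≃* alternatingGroup (Fin 5)) := by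
  classical
  have : Fintype G := Fintype.ofFinite G
  have hsimple : ∀ N : Subgroup G, N.Normal → N = ⊥ ∨ N = ⊤ := by
    intro N hN
    by_cases hbot : N = ⊥
    · exact .inl hbot
    right
    have hsub : ∀ p, (∃ g ∈ N, orderOf g = p) → p = 2 ∨ p = 3 ∨ p = 5 →
        (Finset.univ.filter fun g : G => orderOf g = p) ⊆ Finset.univ.filter (fun g => g ∈ N) := by
      rintro p ⟨g, hg, hgp⟩ hp h hh
      simp only [Finset.mem_filter, Finset.mem_univ, true_and] at hh ⊢
      exact hK N hN p hp g hg hgp h hh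
    let S : ℕ → Finset G := fun p => Finset.univ.filter fun g : G => orderOf g = p ∧ g ∈ N
    have hS : ∀ p, p = 2 ∨ p = 3 ∨ p = 5 →
        (S p).card = 0 ∨ (S p).card = Nat.card {g : G // orderOf g = p} := by
      intro p hp
      by_cases h : ∃ g ∈ N, orderOf g = p
      · right
        obtain ⟨g, hg, hgp⟩ := h
        rw [Nat.card_eq_fintype_card, Fintype.card_subtype]
        congr 1
        ext h
        simp only [S, Finset.mem_filter, Finset.mem_univ, true_and]
        exact ⟨fun h => h.1, fun h' => ⟨h', hK N hN p hp g hg hgp h h'⟩⟩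
      · left
        rw [Finset.card_eq_zero, Finset.filter_eq_empty_iff]
        intro g _ hg
        exact h ⟨g, hg.2, hg.1⟩
    have hu : (Finset.univ.filter fun g : G => g ∈ N) = insert 1 (S 2 ∪ S 3 ∪ S 5) := by
      ext g
      simp only [S, Finset.mem_filter, Finset.mem_univ, true_and, Finset.mem_insert,
        Finset.mem_union]
      constructor
      · intro h
        by_cases h1 : g = 1
        · exact .inl h1
        · have := hord g h1
          tauto
      · rintro (rfl | h)
        · exact N.one_mem
        · tauto
    have hdisj : ∀ p q, p ≠ q → Disjoint (S p) (S q) := by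
      intro p q hpq
      rw [Finset.disjoint_left]
      intro g h1 h2
      simp only [S, Finset.mem_filter] at h1 h2
      exact hpq (h1.2.1.symm.trans h2.2.1)
    have hcN : Nat.card N = 1 + (S 2).card + (S 3).card + (S 5).card := by
      have : Nat.card N = (Finset.univ.filter fun g : G => g ∈ N).card := by
        rw [← Fintype.card_subtype, ← Nat.card_eq_fintype_card]
      rw [this, hu, Finset.card_insert_of_notMem (by simp [S]),
        Finset.card_union_of_disjoint, Finset.card_union_of_disjoint]
      · ring
      · exact hdisj _ _ (by norm_num)
      · rw [Finset.disjoint_union_left]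
        exact ⟨hdisj _ _ (by norm_num), hdisj _ _ (by norm_num)⟩
    have hdvd : Nat.card N ∣ 60 := hG ▸ N.card_subgroup_dvd_card
    have hne1 : Nat.card N ≠ 1 := fun h => hbot (Subgroup.card_eq_one.1 h)
    have e2 := hS 2 (by norm_num)
    have e3 := hS 3 (by norm_num)
    have e5 := hS 5 (by norm_num)
    rw [h2] at e2
    rw [h3] at e3
    rw [h5] at e5
    apply Subgroup.eq_top_of_card_eq
    rw [hG]
    rcases e2 with e2 | e2 <;> rcases e3 with e3 | e3 <;> rcases e5 with e5 | e5 <;>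
      rw [e2, e3, e5] at hcN <;> rw [hcN] at hdvd hne1 ⊢ <;> revert hdvd hne1 <;> norm_num
  have : Fact (Nat.Prime 2) := ⟨by norm_num⟩
  have : Fact (Nat.Prime 3) := ⟨by norm_num⟩
  have : Fact (Nat.Prime 5) := ⟨by norm_num⟩
  have hcard : ∀ P : Sylow 2 G, Nat.card P = 4 := by
    intro P
    rw [Sylow.card_eq_multiplicity, hG]
    have : (60 : ℕ).factorization 2 = 2 := by
      rw [Nat.factorization_def _ (by norm_num)]
      have : (60:ℕ) = 2 * (2 * 15) := rfl
      rw [this, padicValNat.mul (by norm_num) (by norm_num), padicValNat.self (by norm_num),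
        padicValNat.mul (by norm_num) (by norm_num), padicValNat.self (by norm_num),
        padicValNat.eq_zero_of_not_dvd (by norm_num)]
    rw [this]; norm_num
  have hord2 : ∀ P : Sylow 2 G, ∀ g ∈ P, g ≠ 1 → orderOf g = 2 := by
    intro P g hg hg1
    have h := Subgroup.orderOf_dvd_natCard (P : Subgroup G) hg
    have h' := hcard P
    change Nat.card (P : Subgroup G) = 4 at h'
    rw [h'] at h
    rcases hord g hg1 with h1 | h1 | h1
    · exact h1
    · rw [h1] at h; norm_num at h
    · rw [h1] at h; norm_num at h
  have hcent : ∀ t : G, orderOf t = 2 → Nat.card (Subgroup.centralizer {t}) ≤ 4 := by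
    intro t ht
    have hd : Nat.card (Subgroup.centralizer {t}) ∣ 60 := hG ▸ Subgroup.card_subgroup_dvd_card _
    have hno : ∀ p, p = 3 ∨ p = 5 → p.Prime → ¬ p ∣ Nat.card (Subgroup.centralizer {t}) := by
      intro p hp hpp h
      have : Fact p.Prime := ⟨hpp⟩
      obtain ⟨u, hu⟩ := exists_prime_orderOf_dvd_card' (G := Subgroup.centralizer {t}) p h
      have hu' : orderOf (u : G) = p := by rw [Subgroup.orderOf_coe, hu]
      have hcomm : Commute (u : G) t := by
        have := u.2
        rw [Subgroup.mem_centralizer_singleton_iff] at this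
        exact this
      have ho := hcomm.orderOf_mul_eq_mul_orderOf_of_coprime
        (by rw [hu', ht]; rcases hp with rfl | rfl <;> norm_num)
      rw [hu', ht] at ho
      have h1 : (u : G) * t ≠ 1 := by
        intro h; rw [h, orderOf_one] at ho; omega
      have := hord _ h1
      omega
    have n3 := hno 3 (by norm_num) (by norm_num)
    have n5 := hno 5 (by norm_num) (by norm_num)
    have hc : Nat.Coprime (Nat.card (Subgroup.centralizer {t})) 15 := by
      have : (15 : ℕ) = 3 * 5 := rfl
      rw [this]
      exact Nat.Coprime.mul_right (((Nat.Prime.coprime_iff_not_dvd (by norm_num)).2 n3).symm)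
        (((Nat.Prime.coprime_iff_not_dvd (by norm_num)).2 n5).symm)
    have : (60 : ℕ) = 15 * 4 := rfl
    rw [this] at hd
    exact Nat.le_of_dvd (by norm_num) (hc.dvd_of_dvd_mul_left hd)
  have hPc : ∀ P : Sylow 2 G, ∀ t ∈ P, t ≠ 1 → (P : Subgroup G) = Subgroup.centralizer {t} := by
    intro P t ht ht1
    apply Subgroup.eq_of_le_of_card_ge
    · intro g hg
      rw [Subgroup.mem_centralizer_singleton_iff]
      have hsq : ∀ x ∈ P, x * x = 1 := by
        intro x hx
        by_cases hx1 : x = 1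
        · simp [hx1]
        · rw [← pow_two, ← hord2 P x hx hx1, pow_orderOf_eq_one]
      have h1 := inv_eq_of_mul_eq_one_right (hsq g hg)
      have h2 := inv_eq_of_mul_eq_one_right (hsq t ht)
      have h3 := inv_eq_of_mul_eq_one_right (hsq (g * t) (P.mul_mem hg ht))
      rw [mul_inv_rev, h1, h2] at h3
      exact h3.symm
    · exact (hcent t (hord2 P t ht ht1)).trans (hcard P).ge
  have hTI : ∀ P Q : Sylow 2 G, ∀ g ∈ P, g ∈ Q → g ≠ 1 → P = Q := by
    intro P Q g hP hQ hg1
    apply Sylow.ext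
    rw [hPc P g hP hg1, hPc Q g hQ hg1]
  have hn := card_order_eq 2 4 hcard hord2 hTI
  rw [h2] at hn
  have hn5 : Nat.card (Sylow 2 G) = 5 := by omega
  refine alt_of 5 hn5 (MulAction.toPermHom G (Sylow 2 G)) ?_ (by rw [hG]; rfl)
  rcases hsimple _ (MonoidHom.normal_ker (MulAction.toPermHom G (Sylow 2 G))) with h | h
  · exact h
  · exfalso
    have : Subsingleton (Sylow 2 G) := by
      constructor
      intro P Q
      obtain ⟨g, hg⟩ := MulAction.exists_smul_eq G P Q
      have hgk : g ∈ (MulAction.toPermHom G (Sylow 2 G)).ker := by rw [h]; trivial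
      rw [MonoidHom.mem_ker] at hgk
      have : g • P = P := congrArg (fun σ => σ P) hgk
      rw [← hg, this]
    have : Nat.card (Sylow 2 G) ≤ 1 := Finite.card_le_one_iff_subsingleton.2 this
    omega

section act
open MulAction

set_option linter.unusedSectionVars false
variable {G X : Type} [Group G] [Finite G] [Finite X] [MulAction G X]

lemma fixed_le_two (hfix : ∀ g : G, g ≠ 1 → (fixedBy X g).ncard = 2) (g : G) (S : Set X)
    (hS : 2 < S.ncard) (h : ∀ x ∈ S, g • x = x) : g = 1 := by
  by_contra hg
  have h1 := hfix g hg
  have h2 : S ⊆ fixedBy X g := fun x hx => h x hx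
  have := Set.ncard_le_ncard h2 (Set.toFinite _)
  omega

lemma orb_stab (x : X) : (orbit G x).ncard * Nat.card (stabilizer G x) = Nat.card G := by
  rw [← index_stabilizer, Subgroup.index_mul_card]

lemma stab_card_eq {x y : X} (h : y ∈ orbit G x) :
    Nat.card (stabilizer G y) = Nat.card (stabilizer G x) := by
  have h1 := orb_stab (G := G) x
  have h2 := orb_stab (G := G) y
  rw [orbit_eq_iff.2 h] at h2
  have h3 : 0 < (orbit G x).ncard := by
    rw [Set.ncard_pos]; exact nonempty_orbit x
  exact Nat.eq_of_mul_eq_mul_left h3 (h2.trans h1.symm)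

lemma cyclic_case (hcyc : ∀ x : X, IsCyclic (stabilizer G x)) (x : X)
    (h : (orbit G x).ncard = 1) : IsCyclic G := by
  rw [← index_stabilizer, Subgroup.index_eq_one] at h
  have := hcyc x
  rw [h] at this
  exact isCyclic_of_surjective (Subgroup.topEquiv (G := G)) (Subgroup.topEquiv (G := G)).surjective

lemma dihedral_case (hfix : ∀ g : G, g ≠ 1 → (fixedBy X g).ncard = 2)
    (hcyc : ∀ x : X, IsCyclic (stabilizer G x)) (x : X)
    (h : (orbit G x).ncard = 2) :
    Nonempty (G ≃* DihedralGroup (Nat.card (stabilizer G x))) := by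
  apply dihedral_of _ (by rw [index_stabilizer, h]) (hcyc x)
  intro g hg
  have hg1 : g ≠ 1 := by rintro rfl; exact hg (Subgroup.one_mem _)
  have hgx : g • x ≠ x := hg
  have horb : orbit G x = {x, g • x} := by
    symm
    apply Set.eq_of_subset_of_ncard_le
    · rintro y (rfl | rfl)
      · exact mem_orbit_self _
      · exact mem_orbit _ _
    · rw [h, Set.ncard_pair hgx.symm]
    · exact Set.toFinite _
  have hggx : g • g • x = x := by
    have : g • g • x ∈ orbit G x := by rw [← mul_smul]; exact mem_orbit _ _
    rw [horb] at this
    rcases this with h | h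
    · exact h
    · exact absurd (smul_left_cancel g h) hgx
  have hf := hfix g hg1
  apply fixed_le_two hfix _ (insert x (fixedBy X g))
  · rw [Set.ncard_insert_of_notMem (by exact hgx), hf]; norm_num
  · rintro y (rfl | hy)
    · rw [mul_smul, hggx]
    · rw [mem_fixedBy] at hy
      rw [mul_smul, hy, hy]

lemma A4_case (hfix : ∀ g : G, g ≠ 1 → (fixedBy X g).ncard = 2) (x : X)
    (h : (orbit G x).ncard = 4) (hG : Nat.card G = 12) :
    Nonempty (G ≃* alternatingGroup (Fin 4)) := by
  refine alt_of (α := orbit G x) 4 h (toPermHom G (orbit G x)) ?_ (by rw [hG]; rfl)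
  rw [eq_bot_iff]
  intro g hg
  rw [MonoidHom.mem_ker] at hg
  rw [Subgroup.mem_bot]
  apply fixed_le_two hfix g (orbit G x) (by omega)
  intro y hy
  have : g • (⟨y, hy⟩ : orbit G x) = ⟨y, hy⟩ := congrArg (fun σ => σ (⟨y, hy⟩ : orbit G x)) hg
  exact congrArg Subtype.val this

lemma exists_fixed (hfix : ∀ g : G, g ≠ 1 → (fixedBy X g).ncard = 2) (g : G) (hg : g ≠ 1) :
    ∃ x : X, g ∈ stabilizer G x := by
  have : (fixedBy X g).Nonempty := by
    rw [← Set.ncard_pos, hfix g hg]; norm_num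
  obtain ⟨x, hx⟩ := this
  exact ⟨x, hx⟩

lemma count_order (hfix : ∀ g : G, g ≠ 1 → (fixedBy X g).ncard = 2) (p : ℕ) (hp : p.Prime)
    (x : X) (hx : Nat.card (stabilizer G x) = p)
    (hu : ∀ y : X, p ∣ Nat.card (stabilizer G y) → y ∈ orbit G x) :
    (orbit G x).ncard + 2 * Nat.card {g : G // orderOf g = p} = Nat.card G := by
  classical
  have : Fintype G := Fintype.ofFinite G
  have : Fintype (Quotient (orbitRel G (orbit G x))) := Fintype.ofFinite _
  have : ∀ g : G, Fintype (fixedBy (orbit G x) g) := fun g => Fintype.ofFinite _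
  have hB := sum_card_fixedBy_eq_card_orbits_mul_card_group G (orbit G x)
  have h1 : Fintype.card (Quotient (orbitRel G (orbit G x))) = 1 := by
    rw [Fintype.card_eq_one_iff_nonempty_unique]
    have : Subsingleton (Quotient (orbitRel G (orbit G x))) :=
      (pretransitive_iff_subsingleton_quotient G (orbit G x)).1 inferInstance
    exact ⟨uniqueOfSubsingleton (Quotient.mk'' ⟨x, mem_orbit_self x⟩)⟩
  rw [h1, one_mul] at hB
  have hval : ∀ g : G, Fintype.card (fixedBy (orbit G x) g) =
      (if g = 1 then (orbit G x).ncard else 0) + (if orderOf g = p then 2 else 0) := by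
    intro g
    have hE : Fintype.card (fixedBy (orbit G x) g) = (fixedBy X g ∩ orbit G x).ncard := by
      rw [← Nat.card_eq_fintype_card, ← Nat.card_coe_set_eq]
      exact Nat.card_congr
        { toFun := fun y => ⟨y.1.1, congrArg Subtype.val y.2, y.1.2⟩
          invFun := fun y => ⟨⟨y.1, y.2.2⟩, Subtype.ext y.2.1⟩
          left_inv := fun y => rfl
          right_inv := fun y => rfl }
    rw [hE]
    by_cases hg : g = 1
    · subst hg
      have : 1 ≠ p := hp.one_lt.ne
      simp [this]
    · by_cases ho : orderOf g = p
      · have : fixedBy X g ∩ orbit G x = fixedBy X g := by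
          rw [Set.inter_eq_left]
          intro y hy
          apply hu
          rw [← ho]
          exact Subgroup.orderOf_dvd_natCard (stabilizer G y) hy
        rw [this, hfix g hg]; simp [hg, ho]
      · have : fixedBy X g ∩ orbit G x = ∅ := by
          rw [Set.eq_empty_iff_forall_notMem]
          rintro y ⟨hy, hyx⟩
          have h1 := Subgroup.orderOf_dvd_natCard (stabilizer G y) hy
          rw [stab_card_eq hyx, hx] at h1
          rcases (Nat.dvd_prime hp).1 h1 with h | h
          · exact hg (orderOf_eq_one_iff.1 h)
          · exact ho h
        rw [this]; simp [hg, ho]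
  rw [Finset.sum_congr rfl (fun g _ => hval g), Finset.sum_add_distrib, Finset.sum_ite_eq'] at hB
  rw [Nat.card_eq_fintype_card, Nat.card_eq_fintype_card, ← hB, Fintype.card_subtype,
    ← Finset.sum_filter]
  simp [mul_comm]

lemma conj_order (hfix : ∀ g : G, g ≠ 1 → (fixedBy X g).ncard = 2) (p : ℕ) (hp : p.Prime)
    (x : X) (hx : Nat.card (stabilizer G x) = p)
    (hu : ∀ y : X, p ∣ Nat.card (stabilizer G y) → y ∈ orbit G x)
    (N : Subgroup G) (hN : N.Normal) (g : G) (hg : g ∈ N) (hgp : orderOf g = p)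
    (h : G) (hh : orderOf h = p) : h ∈ N := by
  have key : ∀ g : G, orderOf g = p → ∃ y ∈ orbit G x, g ∈ stabilizer G y ∧
      Nat.card (stabilizer G y) = p := by
    intro g hg
    have hg1 : g ≠ 1 := by
      rintro rfl; rw [orderOf_one] at hg; exact hp.one_lt.ne hg
    obtain ⟨y, hy⟩ := exists_fixed hfix g hg1
    have hyx := hu y (hg ▸ Subgroup.orderOf_dvd_natCard _ hy)
    exact ⟨y, hyx, hy, (stab_card_eq hyx).trans hx⟩
  obtain ⟨y, hy, hgy, hyc⟩ := key g hgp
  obtain ⟨z, hz, hhz, hzc⟩ := key h hh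
  have hle : stabilizer G y ≤ N := by
    have : Subgroup.zpowers g = stabilizer G y := by
      apply Subgroup.eq_of_le_of_card_ge
      · exact Subgroup.zpowers_le.2 hgy
      · rw [Nat.card_zpowers, hyc, hgp]
    rw [← this]; exact Subgroup.zpowers_le.2 hg
  have : z ∈ orbit G y := by rw [orbit_eq_iff.2 hy]; exact hz
  obtain ⟨k, rfl⟩ := this
  have h1 : k⁻¹ * h * k ∈ stabilizer G y := by
    rw [mem_stabilizer_iff] at hhz ⊢
    simp only at hhz
    rw [mul_smul, mul_smul, hhz, inv_smul_smul]
  have := hN.conj_mem _ (hle h1) k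
  simpa [mul_assoc] using this

lemma numeric (N s0 s1 s2 e0 e1 e2 : ℕ) (h0 : s0 * e0 = N) (h1 : s1 * e1 = N) (h2 : s2 * e2 = N)
    (he0 : 2 ≤ e0) (h01 : e0 ≤ e1) (h12 : e1 ≤ e2) (hN : 0 < N)
    (hs : s0 + s1 + s2 = N + 2) :
    s2 = 2 ∨ (N = 12 ∧ s2 = 4) ∨ (N = 24 ∧ e0 = 2 ∧ e1 = 3 ∧ e2 = 4) ∨
    (N = 60 ∧ e0 = 2 ∧ e1 = 3 ∧ e2 = 5) := by
  have a0 : e0 < 3 := by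
    by_contra h
    have : s0 * 3 ≤ N := h0 ▸ Nat.mul_le_mul_left _ (by omega)
    have : s1 * 3 ≤ N := h1 ▸ Nat.mul_le_mul_left _ (by omega)
    have : s2 * 3 ≤ N := h2 ▸ Nat.mul_le_mul_left _ (by omega)
    omega
  obtain rfl : e0 = 2 := by omega
  have a1 : e1 < 4 := by
    by_contra h
    have : s1 * 4 ≤ N := h1 ▸ Nat.mul_le_mul_left _ (by omega)
    have : s2 * 4 ≤ N := h2 ▸ Nat.mul_le_mul_left _ (by omega)
    omega
  have : e1 = 2 ∨ e1 = 3 := by omega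
  rcases this with rfl | rfl
  · left; omega
  · have a2 : e2 < 6 := by
      by_contra h
      have : s2 * 6 ≤ N := h2 ▸ Nat.mul_le_mul_left _ (by omega)
      omega
    interval_cases e2 <;> omega

theorem abstract_class (hfix : ∀ g : G, g ≠ 1 → (fixedBy X g).ncard = 2)
    (hcyc : ∀ x : X, IsCyclic (stabilizer G x))
    (hnt : ∀ x : X, ∃ g : G, g ≠ 1 ∧ g • x = x) :
    (∃ n : ℕ, 1 ≤ n ∧ Nonempty (G ≃* Multiplicative (ZMod n))) ∨
    (∃ n : ℕ, 2 ≤ n ∧ Nonempty (G ≃* DihedralGroup n)) ∨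
    Nonempty (G ≃* alternatingGroup (Fin 4)) ∨
    Nonempty (G ≃* Equiv.Perm (Fin 4)) ∨
    Nonempty (G ≃* alternatingGroup (Fin 5)) := by
  classical
  have hcycG : IsCyclic G → ∃ n : ℕ, 1 ≤ n ∧ Nonempty (G ≃* Multiplicative (ZMod n)) := by
    intro h
    exact ⟨Nat.card G, Nat.card_pos, ⟨(zmodCyclicMulEquiv h).symm⟩⟩
  have he2 : ∀ x : X, 2 ≤ Nat.card (stabilizer G x) := by
    intro x
    obtain ⟨g, hg, hgx⟩ := hnt x
    have : Nontrivial (stabilizer G x) :=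
      ⟨⟨⟨g, hgx⟩, 1, fun h => hg (congrArg Subtype.val h)⟩⟩
    exact Finite.one_lt_card
  have hdih : ∀ x : X, (orbit G x).ncard = 2 →
      (∃ n : ℕ, 2 ≤ n ∧ Nonempty (G ≃* DihedralGroup n)) := fun x hx =>
    ⟨_, he2 x, dihedral_case hfix hcyc x hx⟩
  by_cases hN1 : Nat.card G = 1
  · left
    apply hcycG
    have : Subsingleton G := (Nat.card_eq_one_iff_unique.1 hN1).1
    exact isCyclic_of_subsingleton
  have hNpos : 0 < Nat.card G := Nat.card_pos
  have hN2 : 2 ≤ Nat.card G := by omega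
  have : Fintype G := Fintype.ofFinite G
  have : Fintype X := Fintype.ofFinite X
  have : Fintype (Quotient (orbitRel G X)) := Fintype.ofFinite _
  have : ∀ g : G, Fintype (fixedBy X g) := fun g => Fintype.ofFinite _
  have hB := sum_card_fixedBy_eq_card_orbits_mul_card_group G X
  have hsum : ∑ g : G, Fintype.card (fixedBy X g) = Nat.card X + 2 * (Nat.card G - 1) := by
    rw [← Finset.add_sum_erase _ _ (Finset.mem_univ (1 : G))]
    congr 1
    · rw [← Nat.card_eq_fintype_card, fixedBy_one_eq_univ]
      exact Nat.card_congr (Equiv.Set.univ X)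
    · rw [Finset.sum_congr rfl (g := fun _ => 2)]
      · simp [Finset.card_erase_of_mem, mul_comm]
      · intro g hg
        rw [← Nat.card_eq_fintype_card, Nat.card_coe_set_eq]
        exact hfix g (Finset.ne_of_mem_erase hg)
  rw [hsum, ← Nat.card_eq_fintype_card (α := G)] at hB
  let Ω := Quotient (orbitRel G X)
  let s : Ω → ℕ := fun ω => (orbit G ω.out).ncard
  let e : Ω → ℕ := fun ω => Nat.card (stabilizer G ω.out)
  have hse : ∀ ω, s ω * e ω = Nat.card G := fun ω => orb_stab _
  have hX : Nat.card X = ∑ ω : Ω, s ω := by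
    rw [Nat.card_congr (selfEquivSigmaOrbits G X), Nat.card_sigma]
    rfl
  have hs1 : ∀ ω, 1 ≤ s ω := fun ω => by
    have := hse ω
    rcases Nat.eq_zero_or_pos (s ω) with h | h
    · rw [h] at this; omega
    · exact h
  have hs2 : ∀ ω, 2 * s ω ≤ Nat.card G := fun ω => by
    rw [← hse ω, mul_comm]; exact Nat.mul_le_mul_left _ (he2 _)
  have hexx : ∀ x : X, ∃ ω : Ω, x ∈ orbit G ω.out := by
    intro x
    refine ⟨Quotient.mk'' x, ?_⟩
    have : (orbitRel G X) (Quotient.out (Quotient.mk'' x : Ω)) x := Quotient.mk_out x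
    rw [orbitRel_apply] at this
    exact mem_orbit_symm.1 this
  have hr4 : Fintype.card Ω < 4 := by
    by_contra h
    push Not at h
    have h1 : 2 * Nat.card X ≤ Fintype.card Ω * Nat.card G := by
      rw [hX, Finset.mul_sum]
      refine (Finset.sum_le_sum (fun ω _ => hs2 ω)).trans ?_
      simp
    have h2 : 4 * Nat.card G ≤ Fintype.card Ω * Nat.card G := Nat.mul_le_mul_right _ h
    change _ = Fintype.card Ω * Nat.card G at hB
    omega
  change _ = Fintype.card Ω * Nat.card G at hB
  obtain ⟨r, hr⟩ : ∃ r, Fintype.card Ω = r := ⟨_, rfl⟩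
  have f0 : Fin r ≃ Ω := (Fintype.equivFinOfCardEq hr).symm
  let f : Fin r ≃ Ω := (Tuple.sort (e ∘ f0)).trans f0
  have hmono : Monotone (fun i => e (f i)) := Tuple.monotone_sort (e ∘ f0)
  have hXf : Nat.card X = ∑ i, s (f i) := by
    rw [hX]; exact (Equiv.sum_comp f s).symm
  rw [hr] at hB hr4
  interval_cases r
  · omega
  · rw [Fin.sum_univ_one] at hXf
    have := hs1 (f 0)
    omega
  · rw [Fin.sum_univ_two] at hXf
    have h0 := hs1 (f 0)
    have h1 := hs1 (f 1)
    left
    exact hcycG (cyclic_case hcyc (f 0).out (show s (f 0) = 1 by omega))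
  · rw [Fin.sum_univ_three] at hXf
    have h01 : e (f 0) ≤ e (f 1) := hmono (by decide)
    have h12 : e (f 1) ≤ e (f 2) := hmono (by decide)
    have hfin : ∀ x : X, ∃ i : Fin 3, x ∈ orbit G (f i).out := by
      intro x
      obtain ⟨ω, hω⟩ := hexx x
      exact ⟨f.symm ω, by simpa using hω⟩
    rcases numeric (Nat.card G) _ _ _ _ _ _ (hse (f 0)) (hse (f 1)) (hse (f 2)) (he2 _) h01 h12
      hNpos (by omega) with h | ⟨hN, h⟩ | ⟨hN, h0, h1, h2⟩ | ⟨hN, h0, h1, h2⟩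
    · exact .inr (.inl (hdih _ h))
    · exact .inr (.inr (.inl (A4_case hfix _ h hN)))
    · refine .inr (.inr (.inr (.inl ?_)))
      have hst : ∀ x : X, Nat.card (stabilizer G x) = 2 ∨
          (Nat.card (stabilizer G x) = 3 ∧ x ∈ orbit G (f 1).out) ∨
          Nat.card (stabilizer G x) = 4 := by
        intro x
        obtain ⟨i, hi⟩ := hfin x
        rw [stab_card_eq hi]
        change e (f i) = 2 ∨ (e (f i) = 3 ∧ _) ∨ e (f i) = 4
        fin_cases i
        · exact .inl h0
        · exact .inr (.inl ⟨h1, hi⟩)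
        · exact .inr (.inr h2)
      apply S4_of hN
      · intro g hg
        have hg1 : g ≠ 1 := by rintro rfl; rw [orderOf_one] at hg; norm_num at hg
        obtain ⟨x, hx⟩ := exists_fixed hfix g hg1
        have hd := Subgroup.orderOf_dvd_natCard _ hx
        rw [hg] at hd
        rcases hst x with h | ⟨h, _⟩ | h <;> rw [h] at hd <;> norm_num at hd
      · have := count_order hfix 3 (by norm_num) (f 1).out h1 (by
          intro y hy
          rcases hst y with h | ⟨h, h'⟩ | h
          · rw [h] at hy; norm_num at hy
          · exact h'
          · rw [h] at hy; norm_num at hy)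
        have h3 := hse (f 1)
        change s (f 1) + _ = _ at this
        rw [h1] at h3
        omega
    · refine .inr (.inr (.inr (.inr ?_)))
      have hst : ∀ x : X, (Nat.card (stabilizer G x) = 2 ∧ x ∈ orbit G (f 0).out) ∨
          (Nat.card (stabilizer G x) = 3 ∧ x ∈ orbit G (f 1).out) ∨
          (Nat.card (stabilizer G x) = 5 ∧ x ∈ orbit G (f 2).out) := by
        intro x
        obtain ⟨i, hi⟩ := hfin x
        rw [stab_card_eq hi]
        change (e (f i) = 2 ∧ _) ∨ (e (f i) = 3 ∧ _) ∨ (e (f i) = 5 ∧ _)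
        fin_cases i
        · exact .inl ⟨h0, hi⟩
        · exact .inr (.inl ⟨h1, hi⟩)
        · exact .inr (.inr ⟨h2, hi⟩)
      have u2 : ∀ y : X, 2 ∣ Nat.card (stabilizer G y) → y ∈ orbit G (f 0).out := by
        intro y hy
        rcases hst y with ⟨h, h'⟩ | ⟨h, h'⟩ | ⟨h, h'⟩
        · exact h'
        · rw [h] at hy; norm_num at hy
        · rw [h] at hy; norm_num at hy
      have u3 : ∀ y : X, 3 ∣ Nat.card (stabilizer G y) → y ∈ orbit G (f 1).out := by
        intro y hy
        rcases hst y with ⟨h, h'⟩ | ⟨h, h'⟩ | ⟨h, h'⟩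
        · rw [h] at hy; norm_num at hy
        · exact h'
        · rw [h] at hy; norm_num at hy
      have u5 : ∀ y : X, 5 ∣ Nat.card (stabilizer G y) → y ∈ orbit G (f 2).out := by
        intro y hy
        rcases hst y with ⟨h, h'⟩ | ⟨h, h'⟩ | ⟨h, h'⟩
        · rw [h] at hy; norm_num at hy
        · rw [h] at hy; norm_num at hy
        · exact h'
      have p2 : Nat.Prime 2 := by norm_num
      have p3 : Nat.Prime 3 := by norm_num
      have p5 : Nat.Prime 5 := by norm_num
      have c2 := count_order hfix 2 p2 (f 0).out h0 u2
      have c3 := count_order hfix 3 p3 (f 1).out h1 u3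
      have c5 := count_order hfix 5 p5 (f 2).out h2 u5
      have t2 := hse (f 0)
      have t3 := hse (f 1)
      have t5 := hse (f 2)
      rw [h0] at t2
      rw [h1] at t3
      rw [h2] at t5
      change s (f 0) + _ = _ at c2
      change s (f 1) + _ = _ at c3
      change s (f 2) + _ = _ at c5
      apply A5_of hN
      · intro g hg1
        obtain ⟨x, hx⟩ := exists_fixed hfix g hg1
        have hd := Subgroup.orderOf_dvd_natCard _ hx
        have hne : orderOf g ≠ 1 := fun h => hg1 (orderOf_eq_one_iff.1 h)
        rcases hst x with ⟨h, _⟩ | ⟨h, _⟩ | ⟨h, _⟩ <;> rw [h] at hd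
        · exact .inl (((Nat.dvd_prime p2).1 hd).resolve_left hne)
        · exact .inr (.inl (((Nat.dvd_prime p3).1 hd).resolve_left hne))
        · exact .inr (.inr (((Nat.dvd_prime p5).1 hd).resolve_left hne))
      · omega
      · omega
      · omega
      · rintro N hNn p (rfl | rfl | rfl) g hg hgp h hh
        · exact conj_order hfix 2 p2 _ h0 u2 N hNn g hg hgp h hh
        · exact conj_order hfix 3 p3 _ h1 u3 N hNn g hg hgp h hh
        · exact conj_order hfix 5 p5 _ h2 u5 N hNn g hg hgp h hh

end act

/-- Every finite subgroup of `PGL₂(K)` over a field `K` of characteristic zero is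
isomorphic to a cyclic group `ℤ/nℤ` (`n ≥ 1`), a dihedral group of order `2n` (`n ≥ 2`),
the alternating group `A₄`, the symmetric group `S₄`, or the alternating group `A₅`. -/
theorem finite_subgroup_PGL2_charZero_classification
    (K : Type) [Field K] [CharZero K] (H : Subgroup (PGL2 K)) [Finite H] :
    (∃ n : ℕ, 1 ≤ n ∧ Nonempty (H ≃* Multiplicative (ZMod n))) ∨
    (∃ n : ℕ, 2 ≤ n ∧ Nonempty (H ≃* DihedralGroup n)) ∨
    Nonempty (H ≃* alternatingGroup (Fin 4)) ∨
    Nonempty (H ≃* Equiv.Perm (Fin 4)) ∨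
    Nonempty (H ≃* alternatingGroup (Fin 5)) := by
  classical
  let L := AlgebraicClosure K
  have : CharZero L := charZero_of_injective_algebraMap (algebraMap K L).injective
  have hfin : ∀ h : H, IsOfFinOrder (h : PGL2 K) := fun h =>
    (Submonoid.isOfFinOrder_coe (H := H.toSubmonoid)).2 (isOfFinOrder_of_finite h)
  have hfix0 : ∀ h : H, h ≠ 1 → {x : OnePoint L | phi K L h x = x}.ncard = 2 := by
    intro h hh
    obtain ⟨g, hg⟩ := QuotientGroup.mk_surjective (h : PGL2 K)
    have hf := hfin h
    have h1 : (h : PGL2 K) ≠ 1 := fun h' => hh (Subtype.ext h')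
    rw [← hg] at hf h1 ⊢
    exact ncard_fixed (Matrix.GeneralLinearGroup.map (algebraMap K L) g)
      (by
        rw [map_range_iff, ← mem_center_iff_range]
        rwa [Ne, QuotientGroup.eq_one_iff] at h1)
      (not_parabolic g hf)
  let X0 : Set (OnePoint L) := {x | ∃ h : H, h ≠ 1 ∧ phi K L h x = x}
  have hX0 : X0.Finite := by
    have : X0 = ⋃ h : {h : H // h ≠ 1}, {x : OnePoint L | phi K L h.1 x = x} := by
      ext x; simp [X0]
    rw [this]
    apply Set.finite_iUnion
    intro h
    apply Set.finite_of_ncard_ne_zero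
    rw [hfix0 _ h.2]; norm_num
  have : Finite X0 := hX0
  have hinv : ∀ (g : H) (x : X0), phi K L g x.1 ∈ X0 := by
    rintro g ⟨x, h, hh, hx⟩
    refine ⟨g * h * g⁻¹, ?_, ?_⟩
    · rwa [Ne, conj_eq_one_iff]
    · have : phi K L ((g * h * g⁻¹ : H) : PGL2 K) = phi K L g * phi K L h * (phi K L g)⁻¹ := by
        rw [← map_mul, ← map_inv, ← map_mul]; rfl
      rw [this]
      simp [Equiv.Perm.mul_apply, hx]
  let act : MulAction H X0 :=
    { smul := fun g x => ⟨phi K L g x.1, hinv g x⟩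
      one_smul := fun x => Subtype.ext (by
        change phi K L ((1 : H) : PGL2 K) x.1 = x.1
        rw [OneMemClass.coe_one, map_one]; rfl)
      mul_smul := fun g h x => Subtype.ext (by
        change phi K L ((g * h : H) : PGL2 K) x.1 = phi K L g (phi K L h x.1)
        rw [Subgroup.coe_mul, map_mul]; rfl) }
  have hsm : ∀ (g : H) (x : X0), g • x = x ↔ phi K L g x.1 = x.1 := by
    intro g x
    exact Subtype.ext_iff
  refine abstract_class (X := X0) ?_ ?_ ?_
  · intro g hg
    refine Eq.trans ?_ (hfix0 g hg)
    rw [← Set.ncard_image_of_injective _ Subtype.val_injective]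
    congr 1
    ext x
    constructor
    · rintro ⟨y, hy, rfl⟩
      exact (hsm g y).1 hy
    · intro hx
      exact ⟨⟨x, g, hg, hx⟩, (hsm g _).2 hx, rfl⟩
  · intro x
    let eq := (MulAction.stabilizer H x).equivMapOfInjective H.subtype H.subtype_injective
    have : Finite ((MulAction.stabilizer H x).map H.subtype) := Finite.of_equiv _ eq.toEquiv
    have hc : IsCyclic ((MulAction.stabilizer H x).map H.subtype) := by
      apply stab_cyclic (L := L) _ x.1
      rintro _ ⟨h, hh, rfl⟩
      exact (hsm h x).1 hh
    exact isCyclic_of_surjective eq.symm eq.symm.surjective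
  · rintro ⟨x, g, hg, hx⟩
    exact ⟨g, hg, (hsm g _).2 hx⟩
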